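/- Let k be a field, A a finite-dimensional self-injective k-algebra, and M a finitely generated generator for A-mod. In the homotopy category K(A-Mod) of unbounded cochain complexes of left A-modules: (i) the inclusion of the full subcategory of acyclic complexes of injective A-modules into the full subcategory of all acyclic complexes admits a left adjoint; (ii) the inclusion of the full subcategory K_ac(Prj A) of acyclic complexes of projective A-modules into the full subcategory K_ac(Add M) of acyclic complexes all of whose components lie in Add(M) admits a left adjoint. (Lemma 3.5.) -/

import Mathlib

open CategoryTheory
/-! ## Additive closure classes -/

section AddClosure

variable (A : Type) [Ring A]

/-- `X ∈ add M`: `X` is a direct summand of a finite direct sum of copies of `M`. -/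
def MemAdd (M X : ModuleCat.{0} A) : Prop :=
  ∃ (n : ℕ) (Y : ModuleCat.{0} A), Nonempty ((↥X × ↥Y) ≃ₗ[A] (Fin n → ↥M))

/-- `X ∈ Add M`: `X` is a direct summand of an arbitrary direct sum of copies of `M`. -/
def MemAddBig (M X : ModuleCat.{0} A) : Prop :=
  ∃ (I : Type) (Y : ModuleCat.{0} A), Nonempty ((↥X × ↥Y) ≃ₗ[A] (I →₀ ↥M))

/-- a morphism of `A`-modules factors through a projective module -/
def FactorsThroughProj {X Y : ModuleCat.{0} A} (f : X ⟶ Y) : Prop :=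
  ∃ (P : ModuleCat.{0} A) (_ : Module.Projective A P) (g : X ⟶ P) (h : P ⟶ Y), f = g ≫ h

/-- a morphism of `A`-modules factors through a module in `Add M` -/
def FactorsThroughAddM (M : ModuleCat.{0} A) {X Y : ModuleCat.{0} A} (f : X ⟶ Y) : Prop :=
  ∃ (Z : ModuleCat.{0} A) (_ : MemAddBig A M Z) (g : X ⟶ Z) (h : Z ⟶ Y), f = g ≫ h

/-- `X ∈ add M` for unbundled modules. -/
def MemAddPlain (M : Type) [AddCommGroup M] [Module A M]
    (X : Type) [AddCommGroup X] [Module A X] : Prop :=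
  ∃ (n : ℕ) (Y : ModuleCat.{0} A), Nonempty ((X × ↥Y) ≃ₗ[A] (Fin n → M))

end AddClosure

/-! ## Ext vanishing -/

section ExtDefs

variable (A : Type) [Ring A]

/-- vanishing of `Ext^n_A(X, Y)` -/
noncomputable def extZero (n : ℕ) (X Y : ModuleCat.{0} A) : Prop :=
  Subsingleton (((Ext ℤ (ModuleCat.{0} A) n).obj (Opposite.op X)).obj Y)

/-- `M` is self-orthogonal: `Ext^n_A(M,M) = 0` for all `n ≥ 1`. -/
noncomputable def SelfOrthogonal (M : ModuleCat.{0} A) : Prop :=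
  ∀ n : ℕ, 1 ≤ n → extZero A n M M

/-- `M` is a generator for `A`-mod: `A ∈ add M`. -/
def IsGen (M : ModuleCat.{0} A) : Prop :=
  MemAdd A M (ModuleCat.of A A)

/-- membership in the `M`-Gorenstein subcategory `𝒢`:
`Ext^n_A(M,X) = 0 = Ext^n_A(X,M)` for all `n ≥ 1`. -/
noncomputable def MemG (M X : ModuleCat.{0} A) : Prop :=
  ∀ n : ℕ, 1 ≤ n → extZero A n M X ∧ extZero A n X M

end ExtDefs


/-! ## Homotopy categories of complexes -/

section Homotopy

variable (A : Type) [Ring A]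

/-- the homotopy category `K(A-Mod)` of unbounded cochain complexes of `A`-modules. -/
noncomputable abbrev KMod := HomotopyCategory (ModuleCat.{0} A) (ComplexShape.up ℤ)

/-- acyclicity of an object of the homotopy category. -/
def KAcyclic (X : KMod A) : Prop := ∀ i : ℤ, X.as.ExactAt i

/-- the full subcategory `K_ac(A-Mod)` of acyclic complexes. -/
noncomputable abbrev KAc := ObjectProperty.FullSubcategory (fun X : KMod A => KAcyclic A X)

/-- the full subcategory `K_ac(Inj A)` of acyclic complexes of injectives, viewed as a
full subcategory of `K_ac(A-Mod)`. -/
noncomputable abbrev KAcInj :=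
  ObjectProperty.FullSubcategory (fun X : KAc A => ∀ i : ℤ, Module.Injective A ↥(X.obj.as.X i))

/-- the full subcategory `K_ac(Add M)` of acyclic complexes with components in `Add M`. -/
noncomputable abbrev KAcAddM (M : ModuleCat.{0} A) :=
  ObjectProperty.FullSubcategory (fun X : KMod A => KAcyclic A X ∧ ∀ i : ℤ, MemAddBig A M (X.as.X i))

/-- the full subcategory `K_ac(Prj A)` of acyclic complexes of projectives, viewed as a
full subcategory of `K_ac(Add M)` (projective modules lie in `Add M` since `M` is a
generator). -/
noncomputable abbrev KAcPrj (M : ModuleCat.{0} A) :=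
  ObjectProperty.FullSubcategory (fun X : KAcAddM A M => ∀ i : ℤ, Module.Projective A ↥(X.obj.as.X i))

end Homotopy

namespace CochainComplex

open Limits HomComplex

variable {C : Type*} [Category* C]

section SumTotal

variable [Preadditive C] [HasCoproductsOfShape ℕ C]
  (K : ℕ → CochainComplex C ℤ) (e : ∀ j, K j ⟶ K (j + 1))

/-- The inclusion of a term of a sequence of complexes in the coproduct of the terms of total
degree `q`. -/
noncomputable def sumTotalXι (j : ℕ) (p q : ℤ) (h : p + j = q) :
    (K j).X p ⟶ ∐ fun i : ℕ => (K i).X (q - i) :=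
  ((K j).XIsoOfEq (by lia : p = q - j)).hom ≫ Sigma.ι (fun i : ℕ => (K i).X (q - i)) j

variable {K} in
lemma sumTotalX_hom_ext {q : ℤ} {T : C} {f g : (∐ fun i : ℕ => (K i).X (q - i)) ⟶ T}
    (h : ∀ (j : ℕ) (p : ℤ) (hp : p + j = q), sumTotalXι K j p q hp ≫ f = sumTotalXι K j p q hp ≫ g) :
    f = g :=
  Sigma.hom_ext _ _ fun j => by simpa [sumTotalXι] using h j (q - j) (by lia)

/-- The differential of the sum total complex. -/
noncomputable def sumTotalD (q q' : ℤ) (hq : q + 1 = q') :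
    (∐ fun i : ℕ => (K i).X (q - i)) ⟶ ∐ fun i : ℕ => (K i).X (q' - i) :=
  Sigma.desc fun j =>
    (e j).f (q - j) ≫ sumTotalXι K (j + 1) (q - j) q' (by push_cast; lia) +
      (j : ℤ).negOnePow • (K j).d (q - j) (q' - j) ≫ sumTotalXι K j (q' - j) q' (by lia)

lemma sumTotalXι_comp_sumTotalD (j : ℕ) (p p' q q' : ℤ) (hq : q + 1 = q') (h : p + j = q)
    (hp : p + 1 = p') :
    sumTotalXι K j p q h ≫ sumTotalD K e q q' hq =
      (e j).f p ≫ sumTotalXι K (j + 1) p q' (by push_cast; lia) +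
      (j : ℤ).negOnePow • (K j).d p p' ≫ sumTotalXι K j p' q' (by lia) := by
  obtain rfl : p = q - j := by lia
  obtain rfl : p' = q' - j := by lia
  simp [sumTotalXι, sumTotalD]

lemma sumTotalD_comp_sumTotalD (he : ∀ j, e j ≫ e (j + 1) = 0) (q q' q'' : ℤ) (hq : q + 1 = q')
    (hq' : q' + 1 = q'') : sumTotalD K e q q' hq ≫ sumTotalD K e q' q'' hq' = 0 := by
  refine sumTotalX_hom_ext fun j p hp => ?_
  have he' {Z : C} (h : (K (j + 1 + 1)).X p ⟶ Z) : (e j).f p ≫ (e (j + 1)).f p ≫ h = 0 := by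
    rw [← Category.assoc, ← HomologicalComplex.comp_f, he, HomologicalComplex.zero_f, zero_comp]
  rw [comp_zero, ← Category.assoc, sumTotalXι_comp_sumTotalD K e j p (p + 1) q q' hq hp rfl]
  simp only [Preadditive.add_comp, Category.assoc, Linear.units_smul_comp]
  rw [sumTotalXι_comp_sumTotalD K e (j + 1) p (p + 1) q' q'' hq' _ rfl,
    sumTotalXι_comp_sumTotalD K e j (p + 1) (p + 1 + 1) q' q'' hq' _ rfl]
  simp [he', Int.negOnePow_succ]

/-- The total complex, formed with coproducts, of a complex of complexes
`K 0 ⟶ K 1 ⟶ K 2 ⟶ ⋯`. -/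
noncomputable def sumTotal (he : ∀ j, e j ≫ e (j + 1) = 0) : CochainComplex C ℤ :=
  CochainComplex.of (fun q => ∐ fun i : ℕ => (K i).X (q - i))
    (fun q => sumTotalD K e q (q + 1) rfl)
    (fun q => sumTotalD_comp_sumTotalD K e he q (q + 1) (q + 1 + 1) rfl rfl)

variable (he : ∀ j, e j ≫ e (j + 1) = 0)

/-- The inclusion of `K j` in the total complex, as a cochain of degree `j`. -/
noncomputable def sumTotalι (j : ℕ) : Cochain (K j) (sumTotal K e he) j :=
  Cochain.mk fun p q hpq => sumTotalXι K j p q hpq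

lemma δ_sumTotalι (j : ℕ) (m : ℤ) (hm : (j : ℤ) + 1 = m) :
    δ j m (sumTotalι K e he j) =
      (Cochain.ofHom (e j)).comp (sumTotalι K e he (j + 1)) (by push_cast; lia) := by
  ext p q hpq
  obtain rfl : q = p + j + 1 := by lia
  rw [δ_v _ _ hm _ p _ hpq (p + j) (p + 1) (by lia) rfl]
  have h := sumTotalXι_comp_sumTotalD K e j p (p + 1) (p + j) (p + j + 1) rfl rfl rfl
  rw [Cochain.comp_v _ _ _ p p _ (add_zero p) (by push_cast; lia)]
  have h' : sumTotalXι K j p (p + j) rfl ≫ sumTotalD K e (p + j) (p + j + 1) rfl +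
      m.negOnePow • (K j).d p (p + 1) ≫ sumTotalXι K j (p + 1) (p + j + 1) (by lia) =
      (e j).f p ≫ sumTotalXι K (j + 1) p (p + j + 1) (by push_cast; lia) := by
    simp [h, ← hm, Int.negOnePow_succ]
  simp only [sumTotalι, Cochain.mk_v, Cochain.ofHom_v, sumTotal, of_d]
  exact h'

variable {K e he} in
lemma sumTotal_cochain_ext {J : CochainComplex C ℤ} {n : ℤ}
    {z z' : Cochain (sumTotal K e he) J n}
    (h : ∀ (j : ℕ) (m : ℤ) (hm : j + n = m),
      (sumTotalι K e he j).comp z hm = (sumTotalι K e he j).comp z' hm) : z = z' := by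
  ext q r hqr
  refine sumTotalX_hom_ext fun j p hp => ?_
  have := Cochain.congr_v (h j (j + n) rfl) p r (by lia)
  rwa [Cochain.comp_v _ _ _ p q r hp hqr, Cochain.comp_v _ _ _ p q r hp hqr] at this

/-- The cochain from the total complex attached to a family of cochains from its columns. -/
noncomputable def sumTotalDesc {J : CochainComplex C ℤ} {n : ℤ} (m : ℕ → ℤ)
    (hm : ∀ j : ℕ, j + n = m j) (z : ∀ j, Cochain (K j) J (m j)) :
    Cochain (sumTotal K e he) J n :=
  Cochain.mk fun q r hqr => Sigma.desc fun j => (z j).v (q - j) r (by have := hm j; lia)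

lemma sumTotalι_comp_sumTotalDesc {J : CochainComplex C ℤ} {n : ℤ} (m : ℕ → ℤ)
    (hm : ∀ j : ℕ, j + n = m j) (z : ∀ j, Cochain (K j) J (m j)) (j : ℕ) :
    (sumTotalι K e he j).comp (sumTotalDesc K e he m hm z) (hm j) = z j := by
  ext p r hpr
  have := hm j
  obtain ⟨q, hq⟩ : ∃ q : ℤ, p + j = q := ⟨_, rfl⟩
  rw [Cochain.comp_v _ _ _ p q r hq (by lia)]
  obtain rfl : p = q - j := by lia
  change sumTotalXι K j _ q hq ≫ Sigma.desc (fun i : ℕ => (z i).v (q - i) r _) = _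
  simp [sumTotalXι]

end SumTotal

section Extension

lemma δ_ofHom_comp_of_eq [Preadditive C] {F G J : CochainComplex C ℤ} (f : F ⟶ G) {n n' : ℤ}
    (z : Cochain G J n) (h : 0 + n = n') {m m' : ℤ} (h' : 0 + m = m') :
    δ n' m' ((Cochain.ofHom f).comp z h) = (Cochain.ofHom f).comp (δ n m z) h' := by
  obtain rfl : n = n' := by lia
  obtain rfl : m = m' := by lia
  exact δ_ofHom_comp f z m

variable [Abelian C]

/-- Cochains with values in a complex of injective objects extend along exact sequences. -/
lemma exists_ofHom_comp_eq_of_exact {F G H J : CochainComplex C ℤ} (f : F ⟶ G) (g : G ⟶ H)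
    (w : f ≫ g = 0) (hfg : (ShortComplex.mk f g w).Exact) (hJ : ∀ q, Injective (J.X q))
    {n n' n'' : ℤ} (c : Cochain G J n) (h'' : 0 + n = n'')
    (hc : (Cochain.ofHom f).comp c h'' = 0) (h : 0 + n' = n) :
    ∃ c' : Cochain H J n', (Cochain.ofHom g).comp c' h = c := by
  obtain rfl : n' = n := by lia
  obtain rfl : n' = n'' := by lia
  have hex (p : ℤ) : (ShortComplex.mk (f.f p) (g.f p)
      (by simpa using HomologicalComplex.congr_hom w p)).Exact :=
    hfg.map (HomologicalComplex.eval C (ComplexShape.up ℤ) p)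
  have hc' (p q : ℤ) (hpq : p + n' = q) : f.f p ≫ c.v p q hpq = 0 := by
    simpa using Cochain.congr_v hc p q hpq
  refine ⟨Cochain.mk fun p q hpq => (hex p).descToInjective (c.v p q hpq) (hc' p q hpq), ?_⟩
  ext p q hpq
  simpa using (hex p).comp_descToInjective (c.v p q hpq) (hc' p q hpq)

lemma exists_ofHom_comp_eq_of_mono {G H J : CochainComplex C ℤ} (g : G ⟶ H) [Mono g]
    (hJ : ∀ q, Injective (J.X q)) {n n' : ℤ} (c : Cochain G J n)
    (h : 0 + n' = n) : ∃ c' : Cochain H J n', (Cochain.ofHom g).comp c' h = c :=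
  exists_ofHom_comp_eq_of_exact (0 : G ⟶ G) g (by simp)
    ((ShortComplex.exact_iff_mono _ rfl).2 (by dsimp; infer_instance)) hJ c (zero_add n)
    (by simp) h

variable [HasCoproductsOfShape ℕ C]
  (K : ℕ → CochainComplex C ℤ) (e : ∀ j, K j ⟶ K (j + 1)) (he : ∀ j, e j ≫ e (j + 1) = 0)

/-- The morphism to the total complex induced by a coaugmentation. -/
noncomputable def sumTotalAugmentation {X : CochainComplex C ℤ} (η : X ⟶ K 0)
    (hη : η ≫ e 0 = 0) : X ⟶ sumTotal K e he :=
  Cocycle.homOf (Cocycle.mk ((Cochain.ofHom η).comp (sumTotalι K e he 0) (by simp)) 1 (by simp) (by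
    rw [δ_ofHom_comp_of_eq _ _ _ (zero_add 1)]
    have := δ_sumTotalι K e he 0 1 (by simp)
    rw [this]
    rw [← Cochain.comp_assoc (n₁₂ := 0) _ _ _ (by simp) (by simp) (by simp), ← Cochain.ofHom_comp,
      hη]
    simp))

lemma ofHom_sumTotalAugmentation {X : CochainComplex C ℤ} (η : X ⟶ K 0) (hη : η ≫ e 0 = 0) :
    Cochain.ofHom (sumTotalAugmentation K e he η hη) =
      (Cochain.ofHom η).comp (sumTotalι K e he 0) (by simp) := by
  simp [sumTotalAugmentation]

/-- Let `X ⟶ K 0 ⟶ K 1 ⟶ ⋯` be a coresolution of `X` by complexes. A primitive of the restriction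
to `X` of a cocycle on the total complex with values in a complex of injective objects extends to a
primitive of the cocycle. -/
theorem exists_δ_eq_of_coresolution {X : CochainComplex C ℤ} (η : X ⟶ K 0) (hη : η ≫ e 0 = 0)
    [Mono η] (hex₀ : (ShortComplex.mk η (e 0) hη).Exact)
    (hex : ∀ j, (ShortComplex.mk (e j) (e (j + 1)) (he j)).Exact)
    {J : CochainComplex C ℤ} (hJ : ∀ q, Injective (J.X q)) {n₀ n₁ : ℤ} (hn : n₀ + 1 = n₁)
    (β : Cochain (sumTotal K e he) J n₁) (hβ : δ n₁ (n₁ + 1) β = 0) (α : Cochain X J n₀)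
    (hα : δ n₀ n₁ α =
      (Cochain.ofHom (sumTotalAugmentation K e he η hη)).comp β (zero_add n₁)) :
    ∃ γ : Cochain (sumTotal K e he) J n₀, δ n₀ n₁ γ = β ∧
      (Cochain.ofHom (sumTotalAugmentation K e he η hη)).comp γ (zero_add n₀) = α := by
  let βc (j : ℕ) : Cochain (K j) J (j + n₁) := (sumTotalι K e he j).comp β rfl
  have δβc (j : ℕ) : δ (j + n₁) (↑(j + 1) + n₁) (βc j) =
      n₁.negOnePow • (Cochain.ofHom (e j)).comp (βc (j + 1)) (zero_add _) := by
    simp only [βc]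
    rw [δ_comp _ _ _ (j + 1) (n₁ + 1) _ (by push_cast; lia) rfl rfl, hβ, δ_sumTotalι _ _ _ _ _ rfl,
      Cochain.comp_zero, zero_add,
      Cochain.comp_assoc _ _ _ _ (by rfl) (by push_cast; lia)]
  let R (j : ℕ) (z : Cochain (K j) J (j + n₀)) (z' : Cochain (K (j + 1)) J (↑(j + 1) + n₀)) : Prop :=
    (Cochain.ofHom (e j)).comp z' (by push_cast; lia) =
      n₀.negOnePow • (δ (j + n₀) (j + n₁) z - βc j)
  have step_closed (j : ℕ) (z z') (h : R j z z') :
      (Cochain.ofHom (e j)).comp (δ (↑(j + 1) + n₀) (↑(j + 1) + n₁) z' - βc (j + 1))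
        (zero_add _) = 0 := by
    have h' := congr_arg (δ (j + n₁) (↑(j + 1) + n₁)) h
    rw [δ_ofHom_comp_of_eq _ _ _ (zero_add _)] at h'
    have hs : n₁.negOnePow = -n₀.negOnePow := by rw [← hn, Int.negOnePow_succ]
    rw [Cochain.comp_sub, h', δ_units_smul, δ_sub, δ_δ, δβc, hs]
    simp [smul_smul]
  have step (j : ℕ) {F : CochainComplex C ℤ} (f : F ⟶ K j) (w : f ≫ e j = 0)
      (hf : (ShortComplex.mk f (e j) w).Exact) {m : ℤ} (hm : 0 + (j + n₁) = m) (z)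
      (hz : (Cochain.ofHom f).comp (δ (j + n₀) (j + n₁) z - βc j) hm = 0) : ∃ z', R j z z' :=
    exists_ofHom_comp_eq_of_exact f (e j) w hf hJ _ hm
      (by rw [Cochain.comp_units_smul, hz, smul_zero]) (by push_cast; lia)
  obtain ⟨γ₀, hγ₀⟩ := exists_ofHom_comp_eq_of_mono (n' := ((0 : ℕ) : ℤ) + n₀) η hJ α (by simp)
  obtain ⟨γ₁, hγ₁⟩ := step 0 η hη hex₀ (m := n₁) (by simp) γ₀ (by
    rw [Cochain.comp_sub, ← δ_ofHom_comp_of_eq (n' := n₀) η γ₀ (by simp) (by simp), hγ₀, hα,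
      sub_eq_zero, ofHom_sumTotalAugmentation, Cochain.comp_assoc _ _ _ _ _ (by simp)])
  let S (j : ℕ) := {q : Cochain (K j) J (j + n₀) × Cochain (K (j + 1)) J (↑(j + 1) + n₀) //
    R j q.1 q.2}
  have next (j : ℕ) (q : S j) : ∃ q' : S (j + 1), q'.1.1 = q.1.2 := by
    obtain ⟨z', hz'⟩ := step (j + 1) (e j) (he j) (hex j) (zero_add _) q.1.2
      (step_closed j _ _ q.2)
    exact ⟨⟨(q.1.2, z'), hz'⟩, rfl⟩
  choose next hnext using next
  let s (j : ℕ) : S j := Nat.rec ⟨(γ₀, γ₁), hγ₁⟩ next j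
  let γ := sumTotalDesc K e he (fun j => j + n₀) (fun _ => rfl) fun j => (s j).1.1
  have hγ (j : ℕ) : (sumTotalι K e he j).comp γ rfl = (s j).1.1 :=
    sumTotalι_comp_sumTotalDesc K e he _ _ _ j
  refine ⟨γ, ?_, ?_⟩
  · refine sumTotal_cochain_ext fun j m hm => ?_
    subst hm
    have h₁ := δ_comp (sumTotalι K e he j) γ rfl (j + 1) n₁ (j + n₁) (by lia) rfl hn
    rw [hγ, δ_sumTotalι _ _ _ _ _ rfl,
      Cochain.comp_assoc (n₂₃ := ↑(j + 1) + n₀) _ _ _ _ rfl (by push_cast; lia), hγ] at h₁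
    have h₂ : R j (s j).1.1 (s (j + 1)).1.1 := by
      rw [show (s (j + 1)).1.1 = (s j).1.2 from hnext j (s j)]
      exact (s j).2
    dsimp only [R] at h₂
    rw [h₂] at h₁
    rw [smul_smul, Int.units_mul_self, one_smul, add_sub_left_comm, eq_comm, add_eq_left, sub_eq_zero] at h₁
    exact h₁
  · rw [ofHom_sumTotalAugmentation, Cochain.comp_assoc (n₂₃ := ((0 : ℕ) : ℤ) + n₀) _ _ _ _ rfl
      (by simp), hγ]
    exact hγ₀

end Extension

end CochainComplex

namespace CochainComplex

open Limits HomComplex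

variable {C : Type*} [Category* C]

section Approximation

variable [Abelian C] [EnoughInjectives C]

/-- A contractible complex of injective objects in which `Y` embeds. -/
noncomputable def injectiveCone (Y : CochainComplex C ℤ) : CochainComplex C ℤ :=
  CochainComplex.of (fun n => Injective.under (Y.X n) ⊞ Injective.under (Y.X (n + 1)))
    (fun _ => biprod.snd ≫ biprod.inl) (fun _ => by simp)

instance (Y : CochainComplex C ℤ) (n : ℤ) : Injective ((injectiveCone Y).X n) :=
  inferInstanceAs (Injective (Injective.under (Y.X n) ⊞ Injective.under (Y.X (n + 1))))

/-- The embedding of `Y` in a complex of injective objects. -/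
noncomputable def toInjectiveCone (Y : CochainComplex C ℤ) : Y ⟶ injectiveCone Y where
  f n := biprod.lift (Injective.ι (Y.X n)) (Y.d n (n + 1) ≫ Injective.ι (Y.X (n + 1)))
  comm' i j hij := by
    obtain rfl : i + 1 = j := hij
    dsimp only [injectiveCone]
    rw [of_d]
    apply biprod.hom_ext <;> simp

instance (Y : CochainComplex C ℤ) : Mono (toInjectiveCone Y) :=
  have (n : ℤ) : Mono ((toInjectiveCone Y).f n) :=
    mono_of_mono_fac (biprod.lift_fst (Injective.ι (Y.X n)) _)
  HomologicalComplex.mono_of_mono_f _ this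

/-- The cosyzygies of a complex with respect to the embeddings in complexes of injectives. -/
noncomputable def cosyzygy (X : CochainComplex C ℤ) : ℕ → CochainComplex C ℤ
  | 0 => X
  | j + 1 => cokernel (toInjectiveCone (cosyzygy X j))

/-- The projection to the next cosyzygy. -/
noncomputable def toCosyzygy (X : CochainComplex C ℤ) (j : ℕ) :
    injectiveCone (cosyzygy X j) ⟶ cosyzygy X (j + 1) :=
  cokernel.π (toInjectiveCone (cosyzygy X j))

instance (X : CochainComplex C ℤ) (j : ℕ) : Epi (toCosyzygy X j) :=
  inferInstanceAs (Epi (cokernel.π (toInjectiveCone (cosyzygy X j))))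

lemma toInjectiveCone_comp_toCosyzygy (X : CochainComplex C ℤ) (j : ℕ) :
    toInjectiveCone (cosyzygy X j) ≫ toCosyzygy X j = 0 :=
  cokernel.condition _

lemma toInjectiveCone_toCosyzygy_exact (X : CochainComplex C ℤ) (j : ℕ) :
    (ShortComplex.mk _ _ (toInjectiveCone_comp_toCosyzygy X j)).Exact :=
  ShortComplex.exact_cokernel _

/-- The morphisms in the coresolution of a complex by complexes of injective objects. -/
noncomputable def coresolutionMap (X : CochainComplex C ℤ) (j : ℕ) :
    injectiveCone (cosyzygy X j) ⟶ injectiveCone (cosyzygy X (j + 1)) :=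
  toCosyzygy X j ≫ toInjectiveCone (cosyzygy X (j + 1))

lemma toInjectiveCone_comp_coresolutionMap (X : CochainComplex C ℤ) (j : ℕ) :
    toInjectiveCone (cosyzygy X j) ≫ coresolutionMap X j = 0 := by
  rw [coresolutionMap, ← Category.assoc, toInjectiveCone_comp_toCosyzygy, zero_comp]

lemma toInjectiveCone_coresolutionMap_exact (X : CochainComplex C ℤ) (j : ℕ) :
    (ShortComplex.mk _ _ (toInjectiveCone_comp_coresolutionMap X j)).Exact := by
  let φ : ShortComplex.mk _ _ (toInjectiveCone_comp_toCosyzygy X j) ⟶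
      ShortComplex.mk _ _ (toInjectiveCone_comp_coresolutionMap X j) :=
    { τ₁ := 𝟙 _, τ₂ := 𝟙 _, τ₃ := toInjectiveCone (cosyzygy X (j + 1))
      comm₂₃ := by simp [coresolutionMap] }
  have : Epi φ.τ₁ := inferInstanceAs (Epi (𝟙 _))
  have : IsIso φ.τ₂ := inferInstanceAs (IsIso (𝟙 _))
  have : Mono φ.τ₃ := inferInstanceAs (Mono (toInjectiveCone (cosyzygy X (j + 1))))
  exact (ShortComplex.exact_iff_of_epi_of_isIso_of_mono φ).1
    (toInjectiveCone_toCosyzygy_exact X j)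

lemma coresolutionMap_comp_coresolutionMap (X : CochainComplex C ℤ) (j : ℕ) :
    coresolutionMap X j ≫ coresolutionMap X (j + 1) = 0 := by
  rw [coresolutionMap, Category.assoc, toInjectiveCone_comp_coresolutionMap, comp_zero]

lemma coresolutionMap_exact (X : CochainComplex C ℤ) (j : ℕ) :
    (ShortComplex.mk _ _ (coresolutionMap_comp_coresolutionMap X j)).Exact := by
  let φ : ShortComplex.mk _ _ (coresolutionMap_comp_coresolutionMap X j) ⟶
      ShortComplex.mk _ _ (toInjectiveCone_comp_coresolutionMap X (j + 1)) :=
    { τ₁ := toCosyzygy X j, τ₂ := 𝟙 _, τ₃ := 𝟙 _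
      comm₁₂ := by simp [coresolutionMap] }
  have : Epi φ.τ₁ := inferInstanceAs (Epi (toCosyzygy X j))
  have : IsIso φ.τ₂ := inferInstanceAs (IsIso (𝟙 _))
  have : Mono φ.τ₃ := inferInstanceAs (Mono (𝟙 _))
  exact (ShortComplex.exact_iff_of_epi_of_isIso_of_mono φ).2
    (toInjectiveCone_coresolutionMap_exact X (j + 1))

variable [HasCoproductsOfShape ℕ C] (X : CochainComplex C ℤ)

/-- The total complex, formed with coproducts, of a coresolution by complexes of injectives. -/
noncomputable def injectiveApprox : CochainComplex C ℤ :=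
  sumTotal _ (coresolutionMap X) (coresolutionMap_comp_coresolutionMap X)

/-- The morphism from a complex to its approximation by a complex of injectives. -/
noncomputable def toInjectiveApprox : X ⟶ injectiveApprox X :=
  sumTotalAugmentation (X := cosyzygy X 0) _ _ _ (toInjectiveCone (cosyzygy X 0))
    (toInjectiveCone_comp_coresolutionMap X 0)

lemma injective_injectiveApprox_X
    (hC : ∀ F : ℕ → C, (∀ j, Injective (F j)) → Injective (∐ F)) (q : ℤ) :
    Injective ((injectiveApprox X).X q) :=
  hC _ fun _ => inferInstance

variable {X} {J : CochainComplex C ℤ}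

lemma exists_δ_eq_of_toInjectiveApprox (hJ : ∀ q, Injective (J.X q)) {n₀ n₁ : ℤ} (hn : n₀ + 1 = n₁)
    (β : Cochain (injectiveApprox X) J n₁) (hβ : δ n₁ (n₁ + 1) β = 0) (α : Cochain X J n₀)
    (hα : δ n₀ n₁ α = (Cochain.ofHom (toInjectiveApprox X)).comp β (zero_add n₁)) :
    ∃ γ : Cochain (injectiveApprox X) J n₀, δ n₀ n₁ γ = β ∧
      (Cochain.ofHom (toInjectiveApprox X)).comp γ (zero_add n₀) = α :=
  exists_δ_eq_of_coresolution (X := cosyzygy X 0) _ _ _ _ _ (toInjectiveCone_coresolutionMap_exact X 0)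
    (coresolutionMap_exact X) hJ hn β hβ α hα

lemma exists_toInjectiveApprox_comp_eq (hJ : ∀ q, Injective (J.X q)) (f : X ⟶ J) :
    ∃ g : injectiveApprox X ⟶ J, toInjectiveApprox X ≫ g = f := by
  obtain ⟨γ, hγ, hγ'⟩ := exists_δ_eq_of_toInjectiveApprox hJ (zero_add 1) 0 (by simp)
    (Cochain.ofHom f) (by simp)
  refine ⟨Cocycle.homOf (Cocycle.mk γ 1 (zero_add 1) hγ), Cochain.ofHom_injective ?_⟩
  simpa using hγ'

lemma nonempty_homotopy_zero_of_toInjectiveApprox_comp (hJ : ∀ q, Injective (J.X q))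
    (g : injectiveApprox X ⟶ J)
    (h : Homotopy (toInjectiveApprox X ≫ g) 0) : Nonempty (Homotopy g 0) := by
  obtain ⟨γ, hγ, -⟩ := exists_δ_eq_of_toInjectiveApprox hJ (neg_add_cancel 1) (Cochain.ofHom g)
    (by simp) (Cochain.ofHomotopy h) (by simp)
  exact ⟨(Cochain.equivHomotopy g 0).symm ⟨γ, by simp [hγ]⟩⟩

theorem bijective_quotient_map_toInjectiveApprox_comp (hJ : ∀ q, Injective (J.X q)) :
    Function.Bijective fun f : (HomotopyCategory.quotient C (.up ℤ)).obj (injectiveApprox X) ⟶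
      (HomotopyCategory.quotient C (.up ℤ)).obj J =>
        (HomotopyCategory.quotient C (.up ℤ)).map (toInjectiveApprox X) ≫ f := by
  constructor
  · intro f g hfg
    obtain ⟨f, rfl⟩ := (HomotopyCategory.quotient C (.up ℤ)).map_surjective f
    obtain ⟨g, rfl⟩ := (HomotopyCategory.quotient C (.up ℤ)).map_surjective g
    dsimp only at hfg
    rw [← Functor.map_comp, ← Functor.map_comp, ← sub_eq_zero, ← Functor.map_sub,
      ← Preadditive.comp_sub, HomotopyCategory.quotient_map_eq_zero_iff] at hfg
    obtain ⟨h⟩ := nonempty_homotopy_zero_of_toInjectiveApprox_comp hJ (f - g) hfg.some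
    rw [← sub_eq_zero, ← Functor.map_sub, HomotopyCategory.quotient_map_eq_zero_iff]
    exact ⟨h⟩
  · intro f
    obtain ⟨f, rfl⟩ := (HomotopyCategory.quotient C (.up ℤ)).map_surjective f
    obtain ⟨g, rfl⟩ := exists_toInjectiveApprox_comp_eq hJ f
    exact ⟨(HomotopyCategory.quotient C (.up ℤ)).map g, by simp⟩

theorem exactAt_injectiveApprox (hX : X.Acyclic) (n : ℤ) : (injectiveApprox X).ExactAt n := by
  let I := injectiveApprox X
  let S : CochainComplex C ℤ :=
    (HomologicalComplex.single C (ComplexShape.up ℤ) n).obj (Injective.under (I.opcycles n))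
  have hS (q : ℤ) : Injective (S.X q) := by
    by_cases hq : q = n
    · subst hq
      exact Injective.of_iso (HomologicalComplex.singleObjXSelf _ _ _).symm inferInstance
    · exact (HomologicalComplex.isZero_single_obj_X (ComplexShape.up ℤ) n _ q hq).injective
  have : S.IsStrictlyGE n := inferInstanceAs (CochainComplex.IsStrictlyGE
    ((HomologicalComplex.single C (ComplexShape.up ℤ) n).obj (Injective.under (I.opcycles n))) n)
  have := isKInjective_of_injective S n
  let g : I ⟶ S := HomologicalComplex.mkHomToSingle (I.pOpcycles n ≫ Injective.ι _) (by simp)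
  obtain ⟨h⟩ := nonempty_homotopy_zero_of_toInjectiveApprox_comp hS g
    (IsKInjective.homotopyZero _ hX)
  have hg : I.iCycles n ≫ g.f n = 0 := by
    rw [h.comm n, dNext_eq h.hom (show (ComplexShape.up ℤ).Rel n (n + 1) by simp),
      prevD_eq h.hom (show (ComplexShape.up ℤ).Rel (n - 1) n by simp)]
    simpa [S, -HomologicalComplex.iCycles_d_assoc] using
      HomologicalComplex.iCycles_d_assoc I n (n + 1) (h.hom (n + 1) n)
  rw [HomologicalComplex.mkHomToSingle_f] at hg
  have hg' : I.iCycles n ≫ I.pOpcycles n = 0 := by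
    rw [← cancel_mono (Injective.ι (I.opcycles n) ≫
      (HomologicalComplex.singleObjXSelf (ComplexShape.up ℤ) n _).inv)]
    simpa using hg
  rw [HomologicalComplex.exactAt_iff, ShortComplex.exact_iff_iCycles_pOpcycles_zero]
  exact hg'

end Approximation

end CochainComplex

section SelfInjective

universe u

variable {A : Type u} [Ring A]

/-- A simple module over an artinian ring is the quotient by any maximal left ideal which contains
its annihilator. -/
lemma nonempty_linearEquiv_of_annihilator_le [IsArtinianRing A] {S : Type*} [AddCommGroup S]
    [Module A S] [IsSimpleModule A S] (I : Ideal A) [I.IsMaximal]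
    (h : Module.annihilator A S ≤ I) : Nonempty (S ≃ₗ[A] A ⧸ I) := by
  classical
  let f (t : Finset S) : A →ₗ[A] (t → S) := LinearMap.pi fun s => LinearMap.toSpanSingleton A S s
  obtain ⟨_, ⟨t, rfl⟩, ht⟩ := IsArtinian.set_has_minimal
    (Set.range fun t : Finset S => LinearMap.ker (f t)) (Set.range_nonempty _)
  have hker : LinearMap.ker (f t) ≤ I := by
    refine le_trans (fun a ha => Module.mem_annihilator.2 fun s => ?_) h
    have hle : LinearMap.ker (f (insert s t)) ≤ LinearMap.ker (f t) := fun b hb => by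
      ext x
      exact congr_fun hb ⟨x, Finset.mem_insert_of_mem x.2⟩
    have heq := (eq_of_le_of_not_lt hle (ht _ ⟨_, rfl⟩)).ge ha
    exact congr_fun heq ⟨s, Finset.mem_insert_self s t⟩
  obtain ⟨g, hg⟩ := IsSemisimpleModule.extension_property
    ((LinearMap.ker (f t)).liftQ (f t) le_rfl)
    (LinearMap.ker_eq_bot.1 (Submodule.ker_liftQ_eq_bot _ _ _ le_rfl))
    (Submodule.factor hker)
  have hg0 : g ≠ 0 := by
    rintro rfl
    have := LinearMap.congr_fun hg (Submodule.Quotient.mk 1)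
    simp only [LinearMap.zero_comp, LinearMap.zero_apply] at this
    exact (Ideal.ne_top_iff_one I).1 (Ideal.IsMaximal.ne_top ‹_›)
      ((Submodule.Quotient.mk_eq_zero I).1 this.symm)
  have : IsSimpleModule A (A ⧸ I) := isSimpleModule_iff_quot_maximal.2 ⟨I, ‹_›, ⟨.refl _ _⟩⟩
  obtain ⟨s, hs⟩ : ∃ s, g ∘ₗ LinearMap.single A (fun _ : t => S) s ≠ 0 := by
    by_contra! hs
    exact hg0 (LinearMap.pi_ext' fun i => by simpa using hs i)
  exact ⟨.ofBijective _ (LinearMap.bijective_of_ne_zero hs)⟩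

lemma annihilator_quotient_le (I : Ideal A) : Module.annihilator A (A ⧸ I) ≤ I := fun a ha => by
  have := Module.mem_annihilator.1 ha (Submodule.Quotient.mk 1)
  rwa [← Submodule.Quotient.mk_smul, smul_eq_mul, mul_one, Submodule.Quotient.mk_eq_zero] at this

lemma annihilator_sup_annihilator_eq_top [IsArtinianRing A] {S T : Type*} [AddCommGroup S]
    [Module A S] [IsSimpleModule A S] [AddCommGroup T] [Module A T] [IsSimpleModule A T]
    (h : Module.annihilator A S ≠ Module.annihilator A T) :
    Module.annihilator A S ⊔ Module.annihilator A T = ⊤ := by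
  by_contra hne
  obtain ⟨I, hI, hle⟩ := Ideal.exists_le_maximal _ hne
  obtain ⟨e⟩ := nonempty_linearEquiv_of_annihilator_le (S := S) I (le_sup_left.trans hle)
  obtain ⟨e'⟩ := nonempty_linearEquiv_of_annihilator_le (S := T) I (le_sup_right.trans hle)
  exact h (e.trans e'.symm).annihilator_eq

section

variable [Module.Injective A A]

lemma exists_ne_zero_forall_mul_eq_zero (k : Type*) [Field k] [Algebra k A] [FiniteDimensional k A]
    (I : Ideal A) (hI : I ≠ ⊤) (hmul : ∀ a ∈ I, ∀ b, a * b ∈ I) :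
    ∃ x : A, x ≠ 0 ∧ ∀ a ∈ I, x * a = 0 := by
  obtain ⟨t, ht⟩ : (I.restrictScalars k).FG := IsNoetherian.noetherian _
  by_contra! h
  let f : A →ₗ[A] (t → A) := LinearMap.pi fun a => LinearMap.toSpanSingleton A A a
  have hf : Function.Injective f := by
    rw [← LinearMap.ker_eq_bot, Submodule.eq_bot_iff]
    intro x hx
    by_contra hx0
    obtain ⟨a, ha, hxa⟩ := h x hx0
    have hle : Submodule.span k t ≤ LinearMap.ker (LinearMap.mulLeft k x) :=
      Submodule.span_le.2 fun b hb => congr_fun hx ⟨b, hb⟩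
    exact hxa (hle (ht.ge ha))
  obtain ⟨g, hg⟩ := Module.Injective.out f hf LinearMap.id
  apply hI
  rw [Ideal.eq_top_iff_one, ← LinearMap.id_apply (R := A) (1 : A), ← hg 1]
  classical
  rw [LinearMap.pi_apply_eq_sum_univ g]
  refine Submodule.sum_mem _ fun a _ => ?_
  have : (a : A) ∈ I := ht.le (Submodule.subset_span a.2)
  simpa [f] using hmul _ this _

lemma exists_isSimpleModule_forall_mul_eq_zero (k : Type*) [Field k] [Algebra k A]
    [FiniteDimensional k A] [IsArtinianRing A]
    (I : Ideal A) (hI : I ≠ ⊤) (hmul : ∀ a ∈ I, ∀ b, a * b ∈ I) :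
    ∃ S : Ideal A, IsSimpleModule A S ∧ ∀ x ∈ S, ∀ a ∈ I, x * a = 0 := by
  obtain ⟨x, hx, hxI⟩ := exists_ne_zero_forall_mul_eq_zero k I hI hmul
  obtain h | ⟨S, hS, hle⟩ := eq_bot_or_exists_atom_le (Ideal.span {x})
  · simp [hx] at h
  · refine ⟨S, isSimpleModule_iff_isAtom.2 hS, fun y hy a ha => ?_⟩
    obtain ⟨b, rfl⟩ := Ideal.mem_span_singleton'.1 (hle hy)
    rw [mul_assoc, hxI a ha, mul_zero]

/-- Over a left self-injective ring, isomorphic left ideals have the same right annihilators. -/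
lemma forall_mul_eq_zero_of_linearEquiv {S T : Ideal A} (e : S ≃ₗ[A] T) (I : Ideal A)
    (h : ∀ x ∈ S, ∀ a ∈ I, x * a = 0) : ∀ y ∈ T, ∀ a ∈ I, y * a = 0 := by
  intro y hy a ha
  obtain ⟨g, hg⟩ := Module.Injective.out S.subtype S.subtype_injective (T.subtype ∘ₗ e.toLinearMap)
  have hy' : y = e.symm ⟨y, hy⟩ * g 1 := by
    rw [← smul_eq_mul, ← map_smul, smul_eq_mul, mul_one]
    simpa using (hg (e.symm ⟨y, hy⟩)).symm
  rw [hy', mul_assoc]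
  exact h _ (Subtype.property _) _ (I.mul_mem_left _ ha)

/-- A left self-injective finite-dimensional algebra contains all simple left modules. -/
theorem exists_ne_zero_forall_mem_mul_eq_zero (k : Type*) [Field k] [Algebra k A]
    [FiniteDimensional k A] (I : Ideal A) [hI : I.IsMaximal] :
    ∃ c : A, c ≠ 0 ∧ ∀ a ∈ I, a * c = 0 := by
  have := IsArtinianRing.of_finite k A
  let P := {m : Ideal A // ∃ I : Ideal A, I.IsMaximal ∧ m = Module.annihilator A (A ⧸ I)}
  have hsimple {I : Ideal A} (hI : I.IsMaximal) : IsSimpleModule A (A ⧸ I) :=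
    isSimpleModule_iff_quot_maximal.2 ⟨I, hI, ⟨.refl _ _⟩⟩
  have hP (m : P) : ∃ S : Ideal A, IsSimpleModule A S ∧ ∀ x ∈ S, ∀ a ∈ m.1, x * a = 0 := by
    obtain ⟨_, I, hI, rfl⟩ := m
    refine exists_isSimpleModule_forall_mul_eq_zero k _
      (fun h => hI.ne_top (top_le_iff.1 (h.ge.trans (annihilator_quotient_le I))))
      fun a ha b => ?_
    rw [Module.mem_annihilator] at ha ⊢
    intro x
    rw [mul_smul, ha]
  choose S hS hSm using hP
  have hSinj (m n : P) (e : Nonempty (S m ≃ₗ[A] S n)) : m = n := by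
    by_contra hne
    obtain ⟨e⟩ := e
    have hm := forall_mul_eq_zero_of_linearEquiv e m.1 (hSm m)
    have hn := hSm n
    obtain ⟨m, I, hI, rfl⟩ := m
    obtain ⟨n, J, hJ, rfl⟩ := n
    have := hsimple hI
    have := hsimple hJ
    have htop := annihilator_sup_annihilator_eq_top (S := A ⧸ I) (T := A ⧸ J)
      (fun h => hne (Subtype.ext h))
    obtain ⟨a, ha, b, hb, hab⟩ := Submodule.mem_sup.1 ((Ideal.eq_top_iff_one _).1 htop)
    have := hS ⟨_, J, hJ, rfl⟩
    have := IsSimpleModule.nontrivial A (S ⟨_, J, hJ, rfl⟩)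
    obtain ⟨y, hy⟩ := exists_ne (0 : S ⟨_, J, hJ, rfl⟩)
    apply hy
    ext
    rw [← mul_one (y : A), ← hab, mul_add, hm _ y.2 a ha, hn _ y.2 b hb]
    simp
  have hfin : Finite P := by
    let c (m : P) : isotypicComponents A A := ⟨isotypicComponent A A (S m), S m, hS m, rfl⟩
    refine Finite.of_injective c fun m n h => hSinj m n ?_
    have hle := (S m).le_isotypicComponent
    have hc : isotypicComponent A A (S m) = isotypicComponent A A (S n) := Subtype.ext_iff.1 h
    rw [hc] at hle
    exact isIsotypicOfType_submodule_iff.1 (.isotypicComponent A A (S n)) _ hle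
  let t (m : P) : P := ⟨Module.annihilator A (S m), by
    obtain ⟨J, hJ, ⟨e⟩⟩ := isSimpleModule_iff_quot_maximal.1 (hS m)
    exact ⟨J, hJ, e.annihilator_eq⟩⟩
  have ht : Function.Injective t := fun m n h => hSinj m n (by
    obtain ⟨J, hJ, ⟨e⟩⟩ := isSimpleModule_iff_quot_maximal.1 (hS m)
    obtain ⟨e'⟩ := nonempty_linearEquiv_of_annihilator_le (S := S n) J (by
      have hann : Module.annihilator A (S m) = Module.annihilator A (S n) := Subtype.ext_iff.1 h
      rw [← hann, e.annihilator_eq]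
      exact annihilator_quotient_le J)
    exact ⟨e.trans e'.symm⟩)
  obtain ⟨m, hm⟩ := (Finite.injective_iff_surjective.1 ht) ⟨_, I, hI, rfl⟩
  obtain ⟨e⟩ := nonempty_linearEquiv_of_annihilator_le (S := S m) I
    ((Subtype.ext_iff.1 hm).le.trans (annihilator_quotient_le I))
  refine ⟨e.symm (Submodule.Quotient.mk 1), fun h => ?_, fun a ha => ?_⟩
  · rw [Submodule.coe_eq_zero, LinearEquiv.map_eq_zero_iff, Submodule.Quotient.mk_eq_zero] at h
    exact (Ideal.ne_top_iff_one I).1 hI.ne_top h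
  · rw [← smul_eq_mul, ← Submodule.coe_smul, ← map_smul, ← Submodule.Quotient.mk_smul, smul_eq_mul,
      mul_one, (Submodule.Quotient.mk_eq_zero I).2 ha, map_zero, Submodule.coe_zero]

/-- A left self-injective finite-dimensional algebra is a cogenerator. -/
theorem exists_linearMap_apply_ne_zero (k : Type*) [Field k] [Algebra k A]
    [FiniteDimensional k A] {N : Type u} [AddCommGroup N] [Module A N] {x : N} (hx : x ≠ 0) :
    ∃ f : N →ₗ[A] A, f x ≠ 0 := by
  let g := LinearMap.toSpanSingleton A N x
  obtain ⟨I, hI, hle⟩ := Ideal.exists_le_maximal (LinearMap.ker g) (fun h => hx (by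
    simpa [g] using (Ideal.eq_top_iff_one _).1 h))
  obtain ⟨c, hc, hIc⟩ := exists_ne_zero_forall_mem_mul_eq_zero k I
  obtain ⟨f, hf⟩ := Module.Injective.out ((LinearMap.ker g).liftQ g le_rfl)
    (LinearMap.ker_eq_bot.1 (Submodule.ker_liftQ_eq_bot _ _ _ le_rfl))
    ((LinearMap.ker g).liftQ (LinearMap.toSpanSingleton A A c) fun a ha => hIc a (hle ha))
  refine ⟨f, ?_⟩
  have hfx : f (g 1) = (1 : A) • c := hf (Submodule.Quotient.mk 1)
  rw [LinearMap.toSpanSingleton_apply, one_smul, one_smul] at hfx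
  rwa [hfx]

end

lemma injective_of_leftInverse {P Q : Type u} [AddCommGroup P] [Module A P] [AddCommGroup Q]
    [Module A Q] [Module.Injective A Q] (i : P →ₗ[A] Q) (p : Q →ₗ[A] P)
    (h : Function.LeftInverse p i) : Module.Injective A P where
  out _ _ _ _ _ _ f hf g := by
    obtain ⟨l, hl⟩ := Module.Injective.out f hf (i ∘ₗ g)
    exact ⟨p ∘ₗ l, fun x => by simp [hl, h (g x)]⟩

lemma injective_finsupp [IsNoetherianRing A] [Module.Injective A A] (S : Type u) :
    Module.Injective A (S →₀ A) := by
  classical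
  refine Module.Baer.injective fun I g => ?_
  obtain ⟨t, ht⟩ : (⊤ : Submodule A I).FG := IsNoetherian.noetherian _
  let T : Finset S := t.biUnion fun x => (g x).support
  have hT (x : I) : g x ∈ Finsupp.supported A A (T : Set S) := by
    have hle : Submodule.span A t ≤ (Finsupp.supported A A (T : Set S)).comap g :=
      Submodule.span_le.2 fun y hy => (Finsupp.mem_supported A _).2 (by
        exact_mod_cast Finset.subset_biUnion_of_mem (fun x => (g x).support) hy)
    exact hle (ht.ge Submodule.mem_top)
  choose l hl using fun s : S => Module.Injective.out I.subtype I.subtype_injective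
    (Finsupp.lapply s ∘ₗ g)
  refine ⟨∑ s ∈ T, Finsupp.lsingle s ∘ₗ l s, fun x hx => ?_⟩
  have hlx (s : S) : l s x = g ⟨x, hx⟩ s := hl s ⟨x, hx⟩
  ext s
  by_cases hs : s ∈ T
  · simp [Finsupp.finsetSum_apply, Finsupp.single_apply, hlx, hs]
  · have : g ⟨x, hx⟩ s = 0 := Finsupp.notMem_support_iff.1 fun h =>
      hs (((Finsupp.mem_supported A _).1 (hT ⟨x, hx⟩)) h)
    simp [Finsupp.finsetSum_apply, Finsupp.single_apply, hs, this]

lemma injective_of_projective [IsNoetherianRing A] [Module.Injective A A] (P : Type u)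
    [AddCommGroup P] [Module A P] [Module.Projective A P] : Module.Injective A P := by
  obtain ⟨s, hs⟩ := Module.projective_def.1 ‹Module.Projective A P›
  have := injective_finsupp (A := A) P
  exact injective_of_leftInverse s _ hs

/-- Products of copies of a finite-dimensional algebra are free. -/
lemma projective_pi_of_finiteDimensional (k : Type*) [Field k] [Algebra k A]
    [FiniteDimensional k A] (S : Type*) : Module.Projective A (S → A) := by
  let a := Module.finBasis k A
  let b := Module.Basis.ofVectorSpace k (S → k)
  let F := Finsupp.linearCombination A fun j s => algebraMap k A (b j s)
  have hF (f) (i) : (fun s => a.coord i (F f s)) =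
      b.repr.symm (Finsupp.mapRange.linearMap (a.coord i) f) := by
    induction f using Finsupp.induction_linear with
    | zero => ext; simp
    | add f g hf hg =>
      rw [map_add, map_add, map_add, ← hf, ← hg]
      ext
      simp
    | single j x =>
      ext s
      have : x * algebraMap k A (b j s) = b j s • x := by
        rw [Algebra.smul_def, Algebra.commutes]
      simp [F, this, mul_comm]
  have hbij : Function.Bijective F := by
    constructor
    · rw [← LinearMap.ker_eq_bot, Submodule.eq_bot_iff]
      intro f hf
      ext j
      refine a.ext_elem fun i => ?_
      have := hF f i
      rw [LinearMap.mem_ker.1 hf] at this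
      have h0 : b.repr.symm (Finsupp.mapRange.linearMap (a.coord i) f) = 0 := by
        rw [← this]
        ext
        simp
      rw [LinearEquiv.map_eq_zero_iff] at h0
      simpa using DFunLike.congr_fun h0 j
    · intro g
      refine ⟨∑ i, Finsupp.mapRange.linearMap (LinearMap.toSpanSingleton k A (a i))
        (b.repr fun s => a.coord i (g s)), ?_⟩
      ext s
      refine a.ext_elem fun i => ?_
      refine (congr_fun (hF _ i) s).trans ?_
      have : Finsupp.mapRange.linearMap (a.coord i)
          (∑ i, Finsupp.mapRange.linearMap (LinearMap.toSpanSingleton k A (a i))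
            (b.repr fun s => a.coord i (g s))) = b.repr fun s => a.coord i (g s) := by
        ext j
        simp [Finsupp.finsetSum_apply, Finsupp.single_apply]
      rw [this, LinearEquiv.symm_apply_apply]
      rfl
  exact .of_equiv (LinearEquiv.ofBijective F hbij)

/-- Over a left self-injective finite-dimensional algebra, injective and projective modules
coincide. -/
theorem injective_iff_projective_of_finiteDimensional (k : Type*) [Field k] [Algebra k A]
    [FiniteDimensional k A] [Module.Injective A A] (N : Type u) [AddCommGroup N] [Module A N] :
    Module.Injective A N ↔ Module.Projective A N := by
  have := IsNoetherianRing.of_finite k A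
  refine ⟨fun _ => ?_, fun _ => injective_of_projective N⟩
  let i : N →ₗ[A] ((N →ₗ[A] A) → A) := LinearMap.pi fun f => f
  have hi : Function.Injective i := by
    rw [← LinearMap.ker_eq_bot, Submodule.eq_bot_iff]
    intro x hx
    by_contra hx0
    obtain ⟨f, hf⟩ := exists_linearMap_apply_ne_zero (A := A) k hx0
    exact hf (congr_fun hx f)
  obtain ⟨p, hp⟩ := Module.Injective.out i hi LinearMap.id
  have := projective_pi_of_finiteDimensional (A := A) k (N →ₗ[A] A)
  exact .of_split i p (LinearMap.ext hp)

end SelfInjective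

lemma CategoryTheory.ObjectProperty.isRightAdjoint_ι_of_bijective {D : Type*} [Category* D]
    (Q : ObjectProperty D) (P : ObjectProperty Q.FullSubcategory)
    (h : ∀ Z : Q.FullSubcategory, ∃ (Y : Q.FullSubcategory) (u : Z.obj ⟶ Y.obj), P Y ∧
      ∀ W : Q.FullSubcategory, P W →
        Function.Bijective fun f : Y.obj ⟶ W.obj => u ≫ f) :
    P.ι.IsRightAdjoint := by
  rw [Functor.isRightAdjoint_iff_leftAdjointObjIsDefined_eq_top]
  ext Z
  obtain ⟨Y, u, hY, hu⟩ := h Z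
  let c : (P.ι ⋙ coyoneda.obj (.op Z)).CorepresentableBy ⟨Y, hY⟩ :=
    { homEquiv {W} := (P.fullyFaithfulι.homEquiv.trans Q.fullyFaithfulι.homEquiv).trans
        ((Equiv.ofBijective _ (hu W.obj W.property)).trans Q.fullyFaithfulι.homEquiv.symm)
      homEquiv_comp g f := Q.fullyFaithfulι.homEquiv.injective (by
        simp [Functor.FullyFaithful.homEquiv]) }
  simpa using! c.isCorepresentable

section HomotopyModules

open Limits

variable {A : Type} [Ring A]

lemma injective_sigma_of_injective_iff_projective
    (hA : ∀ N : ModuleCat.{0} A, Module.Injective A N ↔ Module.Projective A N)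
    (F : ℕ → ModuleCat.{0} A) (hF : ∀ j, Injective (F j)) : Injective (∐ F) := by
  have (j : ℕ) : Projective (F j) := by
    rw [← IsProjective.iff_projective, ← hA]
    exact (Module.injective_iff_injective_object A _).2 (hF j)
  refine (Module.injective_iff_injective_object A _).1 ((hA _).2 ?_)
  exact (IsProjective.iff_projective _).2 (inferInstanceAs (Projective (∐ F)))

lemma memAddBig_of_leftInverse {M X : ModuleCat.{0} A} {I : Type} (i : X →ₗ[A] (I →₀ M))
    (p : (I →₀ M) →ₗ[A] X) (h : Function.LeftInverse p i) : MemAddBig A M X :=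
  ⟨I, ModuleCat.of A (LinearMap.ker p),
    ⟨{ toFun := fun x => i x.1 + x.2
       map_add' := fun x y => by simp [add_add_add_comm]
       map_smul' := fun a x => by simp
       invFun := fun z => (p z, ⟨z - i (p z), by simp [h _]⟩)
       left_inv := fun ⟨x, y, hy⟩ => by
        have hy : p y = 0 := hy
        simp [h _, hy]
       right_inv := fun z => by simp }⟩⟩

lemma memAddBig_of_projective {M : ModuleCat.{0} A} (hgen : IsGen A M) (P : ModuleCat.{0} A)
    [Module.Projective A P] : MemAddBig A M P := by
  obtain ⟨n, Y, ⟨e⟩⟩ := hgen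
  obtain ⟨s, hs⟩ := Module.projective_def.1 ‹Module.Projective A P›
  let e' : (P →₀ (A × Y)) ≃ₗ[A] (P × Fin n →₀ M) :=
    Finsupp.mapRange.linearEquiv (e.trans (Finsupp.linearEquivFunOnFinite A M (Fin n)).symm) |>.trans
      (Finsupp.curryLinearEquiv A).symm
  refine memAddBig_of_leftInverse
    (e'.toLinearMap ∘ₗ Finsupp.mapRange.linearMap (LinearMap.inl A A Y) ∘ₗ s)
    (Finsupp.linearCombination A id ∘ₗ Finsupp.mapRange.linearMap (LinearMap.fst A A Y) ∘ₗ
      e'.symm.toLinearMap) fun x => ?_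
  have (f : P →₀ A) : Finsupp.mapRange.linearMap (LinearMap.fst A A Y)
      (Finsupp.mapRange.linearMap (LinearMap.inl A A Y) f) = f := by
    ext; simp
  simp only [LinearMap.comp_apply, LinearEquiv.coe_coe, LinearEquiv.symm_apply_apply, this]
  exact hs x

lemma exists_bijective_comp_injective
    (hA : ∀ N : ModuleCat.{0} A, Module.Injective A N ↔ Module.Projective A N)
    (X : KMod A) (hX : KAcyclic A X) :
    ∃ (Y : KMod A) (u : X ⟶ Y), KAcyclic A Y ∧ (∀ i, Module.Injective A (Y.as.X i)) ∧
      ∀ W : KMod A, (∀ i, Module.Injective A (W.as.X i)) →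
        Function.Bijective fun f : Y ⟶ W => u ≫ f :=
  ⟨(HomotopyCategory.quotient _ _).obj (CochainComplex.injectiveApprox X.as),
    (HomotopyCategory.quotient _ _).map (CochainComplex.toInjectiveApprox X.as),
    CochainComplex.exactAt_injectiveApprox hX,
    fun i => (Module.injective_iff_injective_object A _).2
      (CochainComplex.injective_injectiveApprox_X X.as
        (injective_sigma_of_injective_iff_projective hA) i),
    fun W hW => CochainComplex.bijective_quotient_map_toInjectiveApprox_comp (J := W.as) fun i =>
      (Module.injective_iff_injective_object A _).1 (hW i)⟩

end HomotopyModules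

/-- **Lemma 3.5**. For a finite-dimensional self-injective algebra `A` and a finitely
generated generator `M`: (i) the inclusion of the acyclic complexes of injective modules
into all acyclic complexes admits a left adjoint; (ii) the inclusion of the acyclic
complexes of projective modules into the acyclic complexes with components in `Add M`
admits a left adjoint. -/
theorem inclusions_of_acyclic_injectives_and_projectives_have_left_adjoints
    (k A : Type) [Field k] [Ring A] [Algebra k A] [FiniteDimensional k A]
    [Module.Injective A A]
    (M : ModuleCat.{0} A) [Module.Finite A ↥M] (hgen : IsGen A M) :
    (ObjectProperty.ι
        (fun X : KAc A => ∀ i : ℤ, Module.Injective A ↥(X.obj.as.X i))).IsRightAdjoint ∧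
    (ObjectProperty.ι
        (fun X : KAcAddM A M => ∀ i : ℤ,
          Module.Projective A ↥(X.obj.as.X i))).IsRightAdjoint := by
  have hA (N : ModuleCat.{0} A) : Module.Injective A N ↔ Module.Projective A N :=
    injective_iff_projective_of_finiteDimensional k N
  constructor
  · refine ObjectProperty.isRightAdjoint_ι_of_bijective _ _ fun Z => ?_
    obtain ⟨Y, u, hY, hY', hu⟩ := exists_bijective_comp_injective hA Z.obj Z.property
    exact ⟨⟨Y, hY⟩, u, hY', fun W hW => hu W.obj hW⟩
  · refine ObjectProperty.isRightAdjoint_ι_of_bijective _ _ fun Z => ?_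
    obtain ⟨Y, u, hY, hY', hu⟩ := exists_bijective_comp_injective hA Z.obj Z.property.1
    simp only [hA] at hY' hu
    exact ⟨⟨Y, hY, fun i => memAddBig_of_projective hgen _⟩, u, hY', fun W hW => hu W.obj hW⟩
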